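/- arXiv:2410.09369 — 3 statements merged into one kernel-verified Lean document; each statement's English description precedes it below -/
import Mathlib

section
/- Let 0 < α ≤ 1 and α − β < σ < α for some β ∈ (0,α), and let h be continuously differentiable and bounded on [0,∞) with h'(t) = O(t^η) as t → ∞ for some η with −1 < η < α − σ − 1. Define g(t) = (^C D^α_{0^+} [(·+1)^σ h(·)])(t) = (1/Γ(1−α)) ∫_0^t [ σ(s+1)^{σ−1} h(s) + (s+1)^σ h'(s) ] (t−s)^{−α} ds. Then g(t) = O(t^{η+σ−α+1}) as t → ∞. -/
open MeasureTheory Filter Set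

noncomputable def fracInt (γ : ℝ) (f : ℝ → ℝ) (t : ℝ) : ℝ :=
  (1 / Real.Gamma γ) * ∫ s in (0:ℝ)..t, (t - s) ^ (γ - 1) * f s

noncomputable def taylorPolyAt0 (n : ℕ) (f : ℝ → ℝ) (t : ℝ) : ℝ :=
  ∑ k ∈ Finset.range n, iteratedDeriv k f 0 / (Nat.factorial k : ℝ) * t ^ k

noncomputable def caputoD (γ : ℝ) (f : ℝ → ℝ) : ℝ → ℝ :=
  iteratedDeriv ⌈γ⌉₊
    (fun t => fracInt ((⌈γ⌉₊ : ℝ) - γ) (fun s => f s - taylorPolyAt0 ⌈γ⌉₊ f s) t)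

def ContCaputoDiffOnIci (γ : ℝ) (f : ℝ → ℝ) : Prop :=
  ContDiffOn ℝ (⌈γ⌉₊ - 1 : ℕ) f (Set.Ici 0) ∧ ContinuousOn (caputoD γ f) (Set.Ici 0)

def Oscillatory (x : ℝ → ℝ) : Prop :=
  ∃ u : ℕ → ℝ, (∀ n, 0 ≤ u n) ∧ Filter.Tendsto u Filter.atTop Filter.atTop ∧ ∀ n, x (u n) = 0

theorem intervalIntegrable_rpow_mul_one_sub_rpow {a b : ℝ} (ha : -1 < a) (hb : -1 < b) :
    IntervalIntegrable (fun u : ℝ => u ^ a * (1 - u) ^ b) volume 0 1 := by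
  have hB := (Complex.betaIntegral_convergent (u := ((a + 1 : ℝ) : ℂ)) (v := ((b + 1 : ℝ) : ℂ))
    (by simp only [Complex.ofReal_re]; linarith) (by simp only [Complex.ofReal_re]; linarith)).norm
  rw [intervalIntegrable_iff, uIoc_of_le zero_le_one] at hB ⊢
  rw [integrableOn_Ioc_iff_integrableOn_Ioo] at hB ⊢
  refine hB.congr_fun (fun u hu => ?_) measurableSet_Ioo
  have h1 : (1 : ℂ) - (u : ℂ) = ((1 - u : ℝ) : ℂ) := by push_cast; rfl
  simp only [norm_mul]
  rw [h1, Complex.norm_cpow_eq_rpow_re_of_pos hu.1,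
    Complex.norm_cpow_eq_rpow_re_of_pos (sub_pos.2 hu.2)]
  simp

/-- A function dominated by `K * s ^ p` has a convolution with `s ^ (-α)` of order
`t ^ (p - α + 1)`. -/
theorem abs_integral_mul_sub_rpow_le {α p K : ℝ} (hα : α < 1) (hp : -1 < p) {F : ℝ → ℝ}
    (hF : ∀ s > 0, |F s| ≤ K * s ^ p) {t : ℝ} (ht : 0 < t) :
    |∫ s in (0:ℝ)..t, F s * (t - s) ^ (-α)| ≤
      K * (∫ u in (0:ℝ)..1, u ^ p * (1 - u) ^ (-α)) * t ^ (p - α + 1) := by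
  have hI := intervalIntegrable_rpow_mul_one_sub_rpow hp (show -1 < -α by linarith)
  have hI' : IntervalIntegrable
      (fun s : ℝ => K * t ^ (p - α) * ((s / t) ^ p * (1 - s / t) ^ (-α))) volume 0 t := by
    have := (hI.comp_mul_left (c := t⁻¹)).const_mul (K * t ^ (p - α))
    simpa [div_eq_inv_mul] using this
  have hle := intervalIntegral.norm_integral_le_of_norm_le ht.le
    (f := fun s => F s * (t - s) ^ (-α)) (Eventually.of_forall fun s hs => by
      have h1 : t - s = t * (1 - s / t) := by field_simp
      have h2 : 0 ≤ 1 - s / t := sub_nonneg.2 ((div_le_one ht).2 hs.2)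
      have h3 : s ^ p = t ^ p * (s / t) ^ p := by
        rw [← Real.mul_rpow ht.le (div_nonneg hs.1.le ht.le)]
        congr 1
        field_simp
      calc ‖F s * (t - s) ^ (-α)‖ = |F s| * (t - s) ^ (-α) := by
            rw [norm_mul, Real.norm_eq_abs, Real.norm_eq_abs,
              abs_of_nonneg (Real.rpow_nonneg (sub_nonneg.2 hs.2) _)]
        _ ≤ K * s ^ p * (t - s) ^ (-α) :=
            mul_le_mul_of_nonneg_right (hF s hs.1) (Real.rpow_nonneg (sub_nonneg.2 hs.2) _)
        _ = K * t ^ (p - α) * ((s / t) ^ p * (1 - s / t) ^ (-α)) := by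
            rw [h3, h1, Real.mul_rpow ht.le h2, sub_eq_add_neg p α, Real.rpow_add ht]
            ring) hI'
  refine hle.trans (le_of_eq ?_)
  rw [intervalIntegral.integral_const_mul,
    intervalIntegral.integral_comp_div (fun u : ℝ => u ^ p * (1 - u) ^ (-α)) ht.ne',
    zero_div, div_self ht.ne', smul_eq_mul, Real.rpow_add ht, Real.rpow_one]
  ring

theorem exists_abs_deriv_le_of_contDiffOn_Ici {h : ℝ → ℝ} (hh : ContDiffOn ℝ 1 h (Ici 0)) (T : ℝ) :
    ∃ D, 0 ≤ D ∧ ∀ s, 0 < s → s ≤ T → |deriv h s| ≤ D := by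
  have hc : ContinuousOn (derivWithin h (Ici 0)) (Icc 0 T) :=
    (hh.continuousOn_derivWithin (uniqueDiffOn_Ici 0) le_rfl).mono Icc_subset_Ici_self
  obtain ⟨D, hD⟩ := isCompact_Icc.exists_bound_of_continuousOn hc
  refine ⟨|D|, abs_nonneg D, fun s hs hsT => ?_⟩
  rw [← derivWithin_of_mem_nhds (Ici_mem_nhds hs)]
  exact (hD s ⟨hs.le, hsT⟩).trans (le_abs_self D)

/-- The derivative of `(s + 1) ^ σ * h s` is dominated by a multiple of `s ^ (η + σ)` on
the whole positive half-line. -/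
theorem exists_abs_weighted_deriv_le {σ η : ℝ} {h : ℝ → ℝ} (hσ0 : 0 ≤ σ) (hσ1 : σ ≤ 1)
    (hη : -1 ≤ η) (hησ : η + σ ≤ 0) (hh : ContDiffOn ℝ 1 h (Ici 0))
    (hbdd : ∃ C, ∀ t ≥ (0:ℝ), |h t| ≤ C)
    (hh' : ∃ M > (0:ℝ), ∃ T > (0:ℝ), ∀ t ≥ T, |deriv h t| ≤ M * t ^ η) :
    ∃ K, 0 ≤ K ∧ ∀ s > 0,
      |σ * (s + 1) ^ (σ - 1) * h s + (s + 1) ^ σ * deriv h s| ≤ K * s ^ (η + σ) := by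
  obtain ⟨C, hC⟩ := hbdd
  obtain ⟨M, hM, T₀, -, hT₀⟩ := hh'
  have hC0 : 0 ≤ C := (abs_nonneg _).trans (hC 0 le_rfl)
  set T := max T₀ 1
  have hT1 : 1 ≤ T := le_max_right _ _
  have hTpos : 0 < T := zero_lt_one.trans_le hT1
  obtain ⟨D, hD0, hD⟩ := exists_abs_deriv_le_of_contDiffOn_Ici hh T
  have key : ∀ s > 0, |σ * (s + 1) ^ (σ - 1) * h s + (s + 1) ^ σ * deriv h s| ≤
      σ * (s + 1) ^ (σ - 1) * C + (s + 1) ^ σ * |deriv h s| := fun s hs => by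
    refine (abs_add_le _ _).trans ?_
    rw [abs_mul, abs_mul ((s + 1) ^ σ), abs_of_nonneg (by positivity : 0 ≤ σ * (s + 1) ^ (σ - 1)),
      abs_of_nonneg (by positivity : 0 ≤ (s + 1) ^ σ)]
    gcongr
    exact hC s hs.le
  set A := σ * C + (T + 1) ^ σ * D
  set B := σ * C + 2 ^ σ * M
  have hA : 0 ≤ A := by positivity
  have hB : 0 ≤ B := by positivity
  refine ⟨A * T ^ (-(η + σ)) + B, by positivity, fun s hs => (key s hs).trans ?_⟩
  have hsp : 0 < s ^ (η + σ) := Real.rpow_pos_of_pos hs _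
  rw [add_mul]
  rcases le_total s T with hsT | hTs
  · have h1 : (s + 1) ^ (σ - 1) ≤ 1 :=
      Real.rpow_le_one_of_one_le_of_nonpos (by linarith) (by linarith)
    have h2 : (s + 1) ^ σ ≤ (T + 1) ^ σ := by gcongr
    have h3 : T ^ (η + σ) ≤ s ^ (η + σ) := Real.rpow_le_rpow_of_nonpos hs hsT hησ
    have h4 : 1 ≤ T ^ (-(η + σ)) * s ^ (η + σ) := by
      calc (1:ℝ) = T ^ (-(η + σ)) * T ^ (η + σ) := by
            rw [← Real.rpow_add hTpos, neg_add_cancel, Real.rpow_zero]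
        _ ≤ _ := by gcongr
    calc σ * (s + 1) ^ (σ - 1) * C + (s + 1) ^ σ * |deriv h s|
        ≤ σ * 1 * C + (T + 1) ^ σ * D := by
          gcongr
          exact hD s hs hsT
      _ = A * 1 := by simp only [A]; ring
      _ ≤ A * (T ^ (-(η + σ)) * s ^ (η + σ)) := by gcongr
      _ = A * T ^ (-(η + σ)) * s ^ (η + σ) := by ring
      _ ≤ _ := le_add_of_nonneg_right (by positivity)
  · have hs1 : 1 ≤ s := hT1.trans hTs
    have h1 : (s + 1) ^ (σ - 1) ≤ s ^ (η + σ) :=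
      (Real.rpow_le_rpow_of_nonpos hs (by linarith) (by linarith)).trans
        (Real.rpow_le_rpow_of_exponent_le hs1 (by linarith))
    have h2 : (s + 1) ^ σ ≤ 2 ^ σ * s ^ σ := by
      rw [← Real.mul_rpow zero_le_two hs.le]
      gcongr
      linarith
    have h3 : |deriv h s| ≤ M * s ^ η := hT₀ s ((le_max_left _ _).trans hTs)
    calc σ * (s + 1) ^ (σ - 1) * C + (s + 1) ^ σ * |deriv h s|
        ≤ σ * s ^ (η + σ) * C + 2 ^ σ * s ^ σ * (M * s ^ η) := by gcongr
      _ = B * s ^ (η + σ) := by simp only [B, Real.rpow_add hs]; ring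
      _ ≤ _ := le_add_of_nonneg_left (by positivity)

/-- the forcing term `g = D^α ((t+1)^σ h(t))` is `O(t^{η+σ-α+1})`
as `t → ∞`. -/
theorem stmt9
    (α β σ η : ℝ)
    (hα0 : 0 < α) (hα1 : α ≤ 1) (hβ0 : 0 < β) (hβα : β < α)
    (hσ1 : α - β < σ) (hσ2 : σ < α)
    (h : ℝ → ℝ)
    (hh1 : ContDiffOn ℝ 1 h (Set.Ici 0))
    (hhbdd : ∃ C, ∀ t ≥ (0:ℝ), |h t| ≤ C)
    (hη1 : -1 < η) (hη2 : η < α - σ - 1)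
    (hh' : ∃ M > (0:ℝ), ∃ T > (0:ℝ), ∀ t ≥ T, |deriv h t| ≤ M * t ^ η)
    (g : ℝ → ℝ)
    (hgdef : ∀ t ≥ (0:ℝ), g t = (1 / Real.Gamma (1 - α)) *
      ∫ s in (0:ℝ)..t,
        (σ * (s + 1) ^ (σ - 1) * h s + (s + 1) ^ σ * deriv h s) * (t - s) ^ (-α)) :
    ∃ M > (0:ℝ), ∃ T > (0:ℝ), ∀ t ≥ T, |g t| ≤ M * t ^ (η + σ - α + 1) := by
  rcases hα1.eq_or_lt with rfl | hα1
  · refine ⟨1, one_pos, 1, one_pos, fun t ht => ?_⟩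
    rw [hgdef t (by linarith), sub_self, Real.Gamma_zero, div_zero, zero_mul, abs_zero]
    positivity
  · obtain ⟨K, hK, hF⟩ := exists_abs_weighted_deriv_le (σ := σ) (η := η) (by linarith)
      (by linarith) hη1.le (by linarith) hh1 hhbdd hh'
    set M := |1 / Real.Gamma (1 - α)| *
      (K * ∫ u in (0:ℝ)..1, u ^ (η + σ) * (1 - u) ^ (-α))
    refine ⟨|M| + 1, by positivity, 1, one_pos, fun t ht => ?_⟩
    have ht0 : 0 < t := by linarith
    rw [hgdef t ht0.le, abs_mul]
    calc _ ≤ |1 / Real.Gamma (1 - α)| * (K *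
          (∫ u in (0:ℝ)..1, u ^ (η + σ) * (1 - u) ^ (-α)) * t ^ (η + σ - α + 1)) :=
          mul_le_mul_of_nonneg_left
            (abs_integral_mul_sub_rpow_le hα1 (by linarith) hF ht0) (abs_nonneg _)
      _ = M * t ^ (η + σ - α + 1) := by simp only [M]; ring
      _ ≤ (|M| + 1) * t ^ (η + σ - α + 1) := by
          gcongr
          linarith [le_abs_self M]
end

section
/- Let n ≥ 3 be an integer, n − 1 < β < α ≤ ⌈α⌉ = n, a > 0, and let f : ℝ → ℝ, q : [0,∞) → ℝ, g : [0,∞) → ℝ be continuous. Let x be a solution on [0,∞) of (^C D^α_{0^+} x)(t) + a·(^C D^β_{0^+} x)(t) + q(t)·f(x(t)) + sgn(x(t))·g(t) = 0, t > 0, with x(0) = x_0, x^{(i)}(0) = x_i for i = 1,…,n−1, and let y_2 be the associated function. If x is eventually positive and there exist c_5 > 0 and T_3 > 0 with y_2(t) ≥ c_5 for all t ≥ T_3, then limsup_{t→∞} x(t) = ∞. -/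
open MeasureTheory Filter Set

noncomputable def assocY (n : ℕ) (α β a : ℝ) (ξ : ℕ → ℝ) (x : ℝ → ℝ) : ℕ → ℝ → ℝ
  | 1 => fun t => fracInt ((n : ℝ) - α) x t + a * fracInt ((n : ℝ) - β) x t
  | 2 => fun t => caputoD (α - n + 1) x t + a * caputoD (β - n + 1) x t
      + ξ 0 * t ^ ((n : ℝ) - α - 1) / Real.Gamma ((n : ℝ) - α)
      + a * ξ 0 * t ^ ((n : ℝ) - β - 1) / Real.Gamma ((n : ℝ) - β)
  | i => fun t => caputoD (α - n - 1 + i) x t + a * caputoD (β - n - 1 + i) x t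
      + (∑ k ∈ Finset.range (i - 1), ξ k *
          (∏ j ∈ Finset.range (i - 1 - k), ((n : ℝ) - α - i + 2 + k + j)) *
          t ^ ((n : ℝ) - α - i + 1 + k) / Real.Gamma ((n : ℝ) - α + 1))
      + (∑ k ∈ Finset.range (i - 1), a * ξ k *
          (∏ j ∈ Finset.range (i - 1 - k), ((n : ℝ) - β - i + 2 + k + j)) *
          t ^ ((n : ℝ) - β - i + 1 + k) / Real.Gamma ((n : ℝ) - β + 1))

def AbsContOnInterval (f : ℝ → ℝ) (A B : ℝ) : Prop :=
  ∀ ε > (0:ℝ), ∃ δ > (0:ℝ), ∀ m : ℕ, ∀ s t : ℕ → ℝ,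
    (∀ i < m, A ≤ s i ∧ s i ≤ t i ∧ t i ≤ B) →
    (∀ i < m, ∀ j < m, i ≠ j → Disjoint (Set.Ioo (s i) (t i)) (Set.Ioo (s j) (t j))) →
    (∑ i ∈ Finset.range m, (t i - s i)) < δ →
    (∑ i ∈ Finset.range m, |f (t i) - f (s i)|) < ε

theorem intervalIntegrable_one_sub_rpow {γ : ℝ} (hγ : 0 < γ) :
    IntervalIntegrable (fun u : ℝ => (1 - u) ^ (γ - 1)) volume 0 1 := by
  have h := (intervalIntegral.intervalIntegrable_rpow' (a := 0) (b := 1) (r := γ - 1)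
    (by linarith)).comp_sub_left 1
  simpa using h.symm

/-- Rescaling the fractional integral to the unit interval. -/
theorem fracInt_eq_unit_integral (γ : ℝ) (h : ℝ → ℝ) {t : ℝ} (ht : 0 < t) :
    fracInt γ h t =
      (1 / Real.Gamma γ) * (t ^ γ * ∫ u in (0:ℝ)..1, (1 - u) ^ (γ - 1) * h (t * u)) := by
  unfold fracInt
  congr 1
  have hsub := intervalIntegral.mul_integral_comp_mul_left (a := 0) (b := 1)
    (f := fun s => (t - s) ^ (γ - 1) * h s) t
  simp only [mul_zero, mul_one] at hsub
  rw [← hsub, ← intervalIntegral.integral_const_mul, ← intervalIntegral.integral_const_mul]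
  refine intervalIntegral.integral_congr fun u hu => ?_
  rw [uIcc_of_le zero_le_one] at hu
  have hpow : t ^ γ = t * t ^ (γ - 1) := by
    rw [Real.rpow_sub_one ht.ne']
    field_simp
  have hfac : t - t * u = t * (1 - u) := by ring
  simp only [hfac]
  rw [Real.mul_rpow ht.le (by linarith [hu.2]), hpow]
  ring

theorem fracInt_zero (h : ℝ → ℝ) (t : ℝ) : fracInt 0 h t = 0 := by
  simp [fracInt]

theorem exists_abs_fracInt_le {γ : ℝ} (hγ : 0 ≤ γ) {h : ℝ → ℝ} {B : ℝ}
    (hB : ∀ t, 0 ≤ t → |h t| ≤ B) :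
    ∃ C, ∀ t, 0 < t → |fracInt γ h t| ≤ C * t ^ γ := by
  rcases hγ.eq_or_lt with rfl | hγ
  · exact ⟨0, fun t _ => by simp [fracInt_zero]⟩
  refine ⟨|1 / Real.Gamma γ| * ∫ u in (0:ℝ)..1, (1 - u) ^ (γ - 1) * B, fun t ht => ?_⟩
  rw [fracInt_eq_unit_integral γ h ht, abs_mul, abs_mul, abs_of_pos (Real.rpow_pos_of_pos ht γ),
    mul_assoc, mul_comm (∫ u in (0:ℝ)..1, _) (t ^ γ)]
  gcongr
  rw [← Real.norm_eq_abs]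
  refine intervalIntegral.norm_integral_le_of_norm_le zero_le_one (ae_of_all _ fun u hu => ?_)
    ((intervalIntegrable_one_sub_rpow hγ).mul_const B)
  have hu' : 0 ≤ (1 - u) ^ (γ - 1) := Real.rpow_nonneg (by linarith [hu.2]) _
  rw [norm_mul, Real.norm_of_nonneg hu']
  exact mul_le_mul_of_nonneg_left (hB _ (mul_nonneg ht.le hu.1.le)) hu'

theorem differentiableAt_fracInt {γ : ℝ} (hγ : 0 ≤ γ) {h : ℝ → ℝ}
    (hh : ContDiffOn ℝ 1 h (Ici 0)) {t : ℝ} (ht : 0 < t) :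
    DifferentiableAt ℝ (fracInt γ h) t := by
  rcases hγ.eq_or_lt with rfl | hγ
  · rw [show fracInt 0 h = fun _ => 0 from funext (fracInt_zero h)]
    exact differentiableAt_const _
  have hderiv : ∀ s, 0 < s → HasDerivAt h (deriv h s) s := fun s hs =>
    ((hh.differentiableOn one_ne_zero).differentiableAt (Ici_mem_nhds hs)).hasDerivAt
  obtain ⟨K, hK⟩ := (isCompact_Icc (a := (0:ℝ)) (b := 2 * t)).exists_bound_of_continuousOn
    ((hh.continuousOn_derivWithin (uniqueDiffOn_Ici 0) le_rfl).mono Icc_subset_Ici_self)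
  have hK' : ∀ s, 0 < s → s ≤ 2 * t → |deriv h s| ≤ K := fun s hs hst => by
    have := hK s ⟨hs.le, hst⟩
    rwa [derivWithin_of_mem_nhds (Ici_mem_nhds hs)] at this
  have hmeas : ∀ s, 0 < s → AEStronglyMeasurable
      (fun u => (1 - u) ^ (γ - 1) * h (s * u)) (volume.restrict (uIoc 0 1)) := fun s hs => by
    refine (Measurable.aestronglyMeasurable (by fun_prop)).mul ?_
    refine ContinuousOn.aestronglyMeasurable ?_ measurableSet_uIoc
    refine hh.continuousOn.comp (by fun_prop) fun u hu => ?_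
    rw [uIoc_of_le zero_le_one] at hu
    exact mul_nonneg hs.le hu.1.le
  have hcont : IntervalIntegrable (fun u => (1 - u) ^ (γ - 1) * h (t * u)) volume 0 1 := by
    refine (intervalIntegrable_one_sub_rpow hγ).mul_continuousOn ?_
    refine hh.continuousOn.comp (by fun_prop) fun u hu => ?_
    rw [uIcc_of_le zero_le_one] at hu
    exact mul_nonneg ht.le hu.1
  have hint := (intervalIntegral.hasDerivAt_integral_of_dominated_loc_of_deriv_le
    (μ := volume) (a := 0) (b := 1) (x₀ := t) (s := Ioo 0 (2 * t))
    (F := fun s u => (1 - u) ^ (γ - 1) * h (s * u))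
    (F' := fun s u => (1 - u) ^ (γ - 1) * (deriv h (s * u) * u))
    (bound := fun u => (1 - u) ^ (γ - 1) * K)
    (Ioo_mem_nhds ht (by linarith))
    (by filter_upwards [Ioi_mem_nhds ht] with s hs using hmeas s hs)
    hcont
    (((Measurable.mul (by fun_prop)
      (((measurable_deriv h).comp (measurable_const_mul t)).mul measurable_id))).aestronglyMeasurable)
    (ae_of_all _ fun u hu s hs => ?_)
    ((intervalIntegrable_one_sub_rpow hγ).mul_const K)
    (ae_of_all _ fun u hu s hs => ?_)).2
  · refine DifferentiableAt.congr_of_eventuallyEq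
      (((Real.differentiableAt_rpow_const_of_ne γ ht.ne').mul
        hint.differentiableAt).const_mul (1 / Real.Gamma γ)) ?_
    filter_upwards [Ioi_mem_nhds ht] with s hs using fracInt_eq_unit_integral γ h hs
  · rw [uIoc_of_le zero_le_one] at hu
    have hu' : 0 ≤ (1 - u) ^ (γ - 1) := Real.rpow_nonneg (by linarith [hu.2]) _
    rw [norm_mul, Real.norm_of_nonneg hu', norm_mul, Real.norm_of_nonneg hu.1.le]
    refine mul_le_mul_of_nonneg_left ?_ hu'
    have h1 := hK' (s * u) (mul_pos hs.1 hu.1) (by nlinarith [hs.1, hs.2, hu.1, hu.2])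
    exact (mul_le_of_le_one_right (norm_nonneg _) hu.2).trans h1
  · rw [uIoc_of_le zero_le_one] at hu
    have hlin : HasDerivAt (fun r : ℝ => r * u) u s := by
      simpa using (hasDerivAt_id s).mul_const u
    exact ((hderiv (s * u) (mul_pos hs.1 hu.1)).comp s hlin).const_mul _

theorem caputoD_of_mem_Ioc {γ : ℝ} (hγ : γ ∈ Ioc (0:ℝ) 1) (x : ℝ → ℝ) :
    caputoD γ x = deriv (fracInt (1 - γ) (fun s => x s - x 0)) := by
  have hceil : ⌈γ⌉₊ = 1 := by
    rw [Nat.ceil_eq_iff one_ne_zero]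
    simpa using hγ
  unfold caputoD
  rw [hceil, iteratedDeriv_one]
  simp [taylorPolyAt0]

theorem exists_abs_le_of_continuousOn_Ici {x : ℝ → ℝ} {m M : ℝ} (hx : ContinuousOn x (Ici 0))
    (hm : ∀ᶠ t in atTop, m ≤ x t) (hM : ∀ᶠ t in atTop, x t ≤ M) :
    ∃ B, ∀ t, 0 ≤ t → |x t| ≤ B := by
  obtain ⟨R, hR⟩ := eventually_atTop.1 (hm.and hM)
  obtain ⟨K, hK⟩ := (isCompact_Icc (a := (0:ℝ)) (b := R)).exists_bound_of_continuousOn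
    (hx.mono Icc_subset_Ici_self)
  refine ⟨max K (max |m| |M|), fun t ht => ?_⟩
  rcases le_total t R with htR | htR
  · exact (hK t ⟨ht, htR⟩).trans (le_max_left _ _)
  · exact (abs_le_max_abs_abs (hR t htR).1 (hR t htR).2).trans (le_max_right _ _)

theorem tendsto_fracInt_div_atTop {γ : ℝ} (hγ : γ ∈ Ico (0:ℝ) 1) {h : ℝ → ℝ} {B : ℝ}
    (hB : ∀ t, 0 ≤ t → |h t| ≤ B) :
    Tendsto (fun t => fracInt γ h t / t) atTop (nhds 0) := by
  obtain ⟨C, hC⟩ := exists_abs_fracInt_le hγ.1 hB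
  have hlim : Tendsto (fun t : ℝ => C * t ^ (-(1 - γ))) atTop (nhds 0) := by
    simpa using (tendsto_rpow_neg_atTop (sub_pos.2 hγ.2)).const_mul C
  refine squeeze_zero_norm' ?_ hlim
  filter_upwards [eventually_gt_atTop 0] with t ht
  rw [norm_div, Real.norm_of_nonneg ht.le, div_le_iff₀ ht, mul_assoc, neg_sub,
    Real.rpow_sub_one ht.ne', div_mul_cancel₀ _ ht.ne']
  exact hC t ht

/-- A function with derivative eventually bounded below by a positive constant is not `o(t)`. -/
theorem not_tendsto_div_atTop_zero_of_le_deriv {Φ : ℝ → ℝ} {c : ℝ} (hc : 0 < c)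
    (hd : ∀ t, 0 < t → DifferentiableAt ℝ Φ t) (hΦ : ∀ᶠ t in atTop, c ≤ deriv Φ t) :
    ¬ Tendsto (fun t => Φ t / t) atTop (nhds 0) := by
  intro hlim
  obtain ⟨T, hT⟩ := eventually_atTop.1 (hΦ.and (eventually_gt_atTop 0))
  have hgrow : ∀ t ≥ T, c * (t - T) ≤ Φ t - Φ T := fun t ht =>
    (convex_Ici T).mul_sub_le_image_sub_of_le_deriv
      (fun s hs => (hd s (hT s hs).2).continuousAt.continuousWithinAt)
      (fun s hs => (hd s (hT s (interior_subset hs)).2).differentiableWithinAt)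
      (fun s hs => (hT s (interior_subset hs)).1) T self_mem_Ici t ht ht
  have hle : ∀ᶠ t in atTop, c + (Φ T - c * T) * t⁻¹ ≤ Φ t / t := by
    filter_upwards [eventually_ge_atTop T] with t ht
    have htpos := (hT t ht).2
    rw [le_div_iff₀ htpos, add_mul, inv_mul_cancel_right₀ htpos.ne']
    linarith [hgrow t ht]
  have hlow : Tendsto (fun t : ℝ => c + (Φ T - c * T) * t⁻¹) atTop (nhds c) := by
    simpa using (tendsto_inv_atTop_zero.const_mul (Φ T - c * T)).const_add c
  exact absurd (le_of_tendsto_of_tendsto hlow hlim hle) hc.not_ge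

/-- if `x` is eventually positive and `y_2 ≥ c₅ > 0` eventually,
then `limsup_{t→∞} x(t) = ∞`. -/
theorem stmt16
    (n : ℕ) (hn3 : 3 ≤ n)
    (α β a : ℝ)
    (hβ : (n : ℝ) - 1 < β) (hβα : β < α) (hceil : ⌈α⌉₊ = n)
    (ha : 0 < a)
    (f : ℝ → ℝ) (q g : ℝ → ℝ)
    (hfc : Continuous f) (hqc : ContinuousOn q (Set.Ici 0))
    (hgc : ContinuousOn g (Set.Ici 0))
    (ξ : ℕ → ℝ) (x : ℝ → ℝ)
    (hx : ContCaputoDiffOnIci α x)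
    (heq : ∀ t > (0:ℝ),
      caputoD α x t + a * caputoD β x t + q t * f (x t) + Real.sign (x t) * g t = 0)
    (hinit : ∀ i < n, iteratedDeriv i x 0 = ξ i)
    (hxpos : ∃ T > (0:ℝ), ∀ t ≥ T, 0 < x t)
    (hy2 : ∃ c₅ > (0:ℝ), ∃ T₃ > (0:ℝ), ∀ t ≥ T₃, c₅ ≤ assocY n α β a ξ x 2 t) :
    ∀ M : ℝ, ∃ᶠ (t : ℝ) in Filter.atTop, M < x t := by
  intro M hM
  obtain ⟨T, -, hT⟩ := hxpos
  obtain ⟨c, hc, T₃, -, hy⟩ := hy2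
  have hαn : α ≤ n := hceil ▸ Nat.le_ceil α
  have hx1 : ContDiffOn ℝ 1 x (Ici 0) := by
    refine hx.1.of_le ?_
    rw [hceil]
    exact_mod_cast (by omega : 1 ≤ n - 1)
  obtain ⟨B, hB⟩ := exists_abs_le_of_continuousOn_Ici (M := M) hx1.continuousOn
    ((eventually_ge_atTop T).mono fun t ht => (hT t ht).le) (hM.mono fun t ht => not_lt.1 ht)
  set h : ℝ → ℝ := fun s => x s - x 0
  have hh1 : ContDiffOn ℝ 1 h (Ici 0) := hx1.sub contDiffOn_const
  have hhB : ∀ t, 0 ≤ t → |h t| ≤ B + B := fun t ht =>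
    (abs_sub _ _).trans (add_le_add (hB t ht) (hB 0 le_rfl))
  have hdα : ∀ t, 0 < t → DifferentiableAt ℝ (fracInt (n - α) h) t := fun t ht =>
    differentiableAt_fracInt (by linarith) hh1 ht
  have hdβ : ∀ t, 0 < t → DifferentiableAt ℝ (fracInt (n - β) h) t := fun t ht =>
    differentiableAt_fracInt (by linarith) hh1 ht
  have hCα : caputoD (α - n + 1) x = deriv (fracInt (n - α) h) := by
    rw [caputoD_of_mem_Ioc ⟨by linarith, by linarith⟩]
    congr 2; ring
  have hCβ : caputoD (β - n + 1) x = deriv (fracInt (n - β) h) := by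
    rw [caputoD_of_mem_Ioc ⟨by linarith, by linarith⟩]
    congr 2; ring
  have hpow : ∀ δ > (n : ℝ) - 1, ∀ k : ℝ, Tendsto
      (fun t : ℝ => k * t ^ ((n : ℝ) - δ - 1) / Real.Gamma (n - δ)) atTop (nhds 0) := by
    intro δ hδ k
    have := ((tendsto_rpow_neg_atTop (y := δ - n + 1) (by linarith)).const_mul k).div_const
      (Real.Gamma (n - δ))
    rw [mul_zero, zero_div] at this
    refine this.congr fun t => ?_
    congr 3; ring
  have hrest := (hpow α (by linarith) (ξ 0)).add (hpow β hβ (a * ξ 0))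
  rw [add_zero] at hrest
  refine not_tendsto_div_atTop_zero_of_le_deriv
    (Φ := fun t => fracInt (n - α) h t + a * fracInt (n - β) h t) (half_pos hc)
    (fun t ht => (hdα t ht).add ((hdβ t ht).const_mul a)) ?_ ?_
  · filter_upwards [eventually_ge_atTop T₃, eventually_gt_atTop 0,
      hrest.eventually_lt_const (half_pos hc)] with t ht₃ ht0 ht
    have hyt := hy t ht₃
    simp only [assocY, hCα, hCβ] at hyt
    rw [deriv_fun_add (hdα t ht0) ((hdβ t ht0).const_mul a), deriv_const_mul a (hdβ t ht0)]
    linarith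
  · have hlim := (tendsto_fracInt_div_atTop (γ := n - α) ⟨by linarith, by linarith⟩ hhB).add
      ((tendsto_fracInt_div_atTop (γ := n - β) ⟨by linarith, by linarith⟩ hhB).const_mul a)
    rw [mul_zero, add_zero] at hlim
    refine hlim.congr fun t => ?_
    ring
end

section
/- Let n ≥ 3 be an integer, n − 1 < β < α ≤ ⌈α⌉ = n, a > 0, and let f : ℝ → ℝ, q : [0,∞) → ℝ, g : [0,∞) → ℝ be continuous. Let x be an eventually positive solution on [0,∞) of (^C D^α_{0^+} x)(t) + a·(^C D^β_{0^+} x)(t) + q(t)·f(x(t)) + sgn(x(t))·g(t) = 0, t > 0, with x(0) = x_0, x^{(i)}(0) = x_i for i = 1,…,n−1, and let y_1,…,y_n be the associated functions. Assume one of the following holds for all t large enough: (i) (−1)^{i+1} y_i(t) > 0 for all i = 1,…,n; (ii) (−1)^i y_i(t) > 0 for all i = 1,…,n; (iii) y_1 is bounded, y_1(t) > 0, y_2(t) > 0, and (−1)^i y_i(t) > 0 for i = 3,…,n. Then x(t) = O(t^{α−n}) as t → ∞. -/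
open MeasureTheory Filter Set

theorem intervalIntegrable_sub_rpow {r : ℝ} (hr : -1 < r) (t a b : ℝ) :
    IntervalIntegrable (fun s => (t - s) ^ r) volume a b := by
  have h := (intervalIntegral.intervalIntegrable_rpow' (a := t - a) (b := t - b)
    hr).comp_sub_left t
  simpa using h

theorem integral_sub_rpow_mul_sub_rpow {γ η u t : ℝ} (hγ : 0 < γ) (hη : 0 < η) (hut : u < t) :
    ∫ s in u..t, (t - s) ^ (γ - 1) * (s - u) ^ (η - 1)
      = (t - u) ^ (γ + η - 1) * (Real.Gamma γ * Real.Gamma η / Real.Gamma (γ + η)) := by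
  have h0 : 0 < t - u := sub_pos.2 hut
  have h1 : ∫ s in u..t, (t - s) ^ (γ - 1) * (s - u) ^ (η - 1)
      = ∫ s in (0:ℝ)..(t - u), s ^ (η - 1) * ((t - u) - s) ^ (γ - 1) := by
    have := intervalIntegral.integral_comp_sub_right (a := u) (b := t)
      (fun s => s ^ (η - 1) * ((t - u) - s) ^ (γ - 1)) u
    rw [sub_self] at this
    rw [← this]
    refine intervalIntegral.integral_congr fun s _ => ?_
    rw [mul_comm]
    congr 2
    ring
  rw [h1]
  have h2 := Complex.betaIntegral_scaled (η : ℂ) (γ : ℂ) h0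
  have h3 : (∫ s in (0:ℝ)..(t - u), (s : ℂ) ^ ((η : ℂ) - 1) * (((t - u : ℝ) : ℂ) - s) ^ ((γ : ℂ) - 1))
      = ((∫ s in (0:ℝ)..(t - u), s ^ (η - 1) * ((t - u) - s) ^ (γ - 1) : ℝ) : ℂ) := by
    rw [← intervalIntegral.integral_ofReal]
    refine intervalIntegral.integral_congr fun s hs => ?_
    rw [uIcc_of_le h0.le] at hs
    rw [Complex.ofReal_mul, Complex.ofReal_cpow hs.1, Complex.ofReal_cpow (by linarith [hs.2])]
    push_cast
    rfl
  rw [h3, Complex.betaIntegral_eq_Gamma_mul_div _ _ (by simpa) (by simpa), ← Complex.ofReal_add,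
    Complex.Gamma_ofReal, Complex.Gamma_ofReal, Complex.Gamma_ofReal,
    show ((η + γ : ℝ) : ℂ) - 1 = ((η + γ - 1 : ℝ) : ℂ) by push_cast; ring,
    ← Complex.ofReal_cpow h0.le] at h2
  rw [add_comm γ η, mul_comm (Real.Gamma γ)]
  exact_mod_cast h2

theorem fracInt_rpow {γ η t : ℝ} (hγ : 0 < γ) (hη : 0 < η) (ht : 0 < t) :
    fracInt γ (fun s => s ^ (η - 1) / Real.Gamma η) t
      = t ^ (γ + η - 1) / Real.Gamma (γ + η) := by
  have h := integral_sub_rpow_mul_sub_rpow hγ hη ht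
  simp only [sub_zero] at h
  have hG := (Real.Gamma_pos_of_pos hγ).ne'
  have hE := (Real.Gamma_pos_of_pos hη).ne'
  unfold fracInt
  simp only [← mul_div_assoc, intervalIntegral.integral_div]
  rw [h]
  field_simp

theorem fracInt_congr {γ t : ℝ} {f g : ℝ → ℝ} (ht : 0 ≤ t) (h : ∀ s ∈ Ioc 0 t, f s = g s) :
    fracInt γ f t = fracInt γ g t := by
  unfold fracInt
  congr 1
  refine intervalIntegral.integral_congr_ae (Eventually.of_forall fun s hs => ?_)
  rw [uIoc_of_le ht] at hs
  simp only [h s hs]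

theorem fracInt_one (f : ℝ → ℝ) (t : ℝ) : fracInt 1 f t = ∫ s in (0:ℝ)..t, f s := by
  simp [fracInt]

theorem fracInt_eq_scaled {γ t : ℝ} (hγ : 0 < γ) (f : ℝ → ℝ) (ht : 0 ≤ t) :
    fracInt γ f t = 1 / Real.Gamma γ *
      (t ^ γ * ∫ v in (0:ℝ)..1, (1 - v) ^ (γ - 1) * f (t * v)) := by
  rcases ht.eq_or_lt with rfl | ht
  · simp [fracInt, Real.zero_rpow hγ.ne']
  · unfold fracInt
    congr 1
    have h := intervalIntegral.mul_integral_comp_mul_left (a := 0) (b := 1)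
      (f := fun s => (t - s) ^ (γ - 1) * f s) (c := t)
    rw [mul_zero, mul_one] at h
    rw [← h]
    have h2 : ∫ v in (0:ℝ)..1, (t - t * v) ^ (γ - 1) * f (t * v)
        = ∫ v in (0:ℝ)..1, t ^ (γ - 1) * ((1 - v) ^ (γ - 1) * f (t * v)) := by
      refine intervalIntegral.integral_congr fun v hv => ?_
      rw [uIcc_of_le zero_le_one] at hv
      rw [show t - t * v = t * (1 - v) by ring, Real.mul_rpow ht.le (by linarith [hv.2])]
      ring
    rw [h2, intervalIntegral.integral_const_mul, ← mul_assoc, Real.rpow_sub_one ht.ne']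
    field_simp

theorem continuousOn_fracInt {γ : ℝ} (hγ : 0 < γ) {f : ℝ → ℝ} (hf : Continuous f) :
    ContinuousOn (fracInt γ f) (Ici 0) := by
  have hc : Continuous fun t : ℝ => ∫ v in (0:ℝ)..1, (1 - v) ^ (γ - 1) * f (t * v) := by
    rw [continuous_iff_continuousAt]
    intro t₀
    obtain ⟨M, hM⟩ := (isCompact_Icc (a := -(|t₀| + 1)) (b := |t₀| + 1)).exists_bound_of_continuousOn
      hf.continuousOn
    have hi := intervalIntegrable_sub_rpow (r := γ - 1) (by linarith) 1 0 1
    refine intervalIntegral.continuousAt_of_dominated_interval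
      (bound := fun v => (1 - v) ^ (γ - 1) * M) ?_ ?_ (hi.mul_const M) ?_
    · refine Eventually.of_forall fun t => Measurable.aestronglyMeasurable ?_
      have := hf.measurable
      fun_prop
    · filter_upwards [Metric.ball_mem_nhds t₀ one_pos] with t ht
      refine Eventually.of_forall fun v hv => ?_
      rw [uIoc_of_le zero_le_one] at hv
      have h1 : 0 ≤ (1 - v) ^ (γ - 1) := Real.rpow_nonneg (by linarith [hv.2]) _
      rw [norm_mul, Real.norm_of_nonneg h1]
      refine mul_le_mul_of_nonneg_left (hM _ ?_) h1
      rw [mem_Icc, ← abs_le, abs_mul, abs_of_pos hv.1]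
      rw [Metric.mem_ball, Real.dist_eq] at ht
      have : |t| ≤ |t₀| + 1 := by
        have := abs_sub_abs_le_abs_sub t t₀
        linarith
      nlinarith [abs_nonneg t, hv.1, hv.2]
    · exact Eventually.of_forall fun v _ => by fun_prop
  refine ContinuousOn.congr (f := fun t => 1 / Real.Gamma γ *
      (t ^ γ * ∫ v in (0:ℝ)..1, (1 - v) ^ (γ - 1) * f (t * v))) ?_
    fun t ht => fracInt_eq_scaled hγ f ht
  have : Continuous fun t : ℝ => t ^ γ := Real.continuous_rpow_const hγ.le
  fun_prop

theorem intervalIntegrable_kernel_mul {γ t : ℝ} (hγ : 0 < γ) {f : ℝ → ℝ} {a b : ℝ}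
    (hf : ContinuousOn f (uIcc a b)) :
    IntervalIntegrable (fun s => (t - s) ^ (γ - 1) * f s) volume a b :=
  (intervalIntegrable_sub_rpow (by linarith) t a b).mul_continuousOn hf

theorem fracInt_fracInt {γ η t : ℝ} (hγ : 0 < γ) (hη : 0 < η) {f : ℝ → ℝ} (hf : Continuous f)
    (ht : 0 ≤ t) : fracInt γ (fracInt η f) t = fracInt (γ + η) f t := by
  have hfm := hf.measurable
  set F : ℝ → ℝ → ℝ := fun s u =>
    if u < s then (t - s) ^ (γ - 1) * ((s - u) ^ (η - 1) * f u) else 0 with hF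
  have hFm : Measurable (Function.uncurry F) := by
    refine Measurable.ite (measurableSet_lt measurable_snd measurable_fst) ?_ measurable_const
    fun_prop
  obtain ⟨M, hM⟩ := (isCompact_Icc (a := 0) (b := t)).exists_bound_of_continuousOn hf.continuousOn
  have sec : ∀ s ∈ Ioc 0 t, ∀ φ : ℝ → ℝ,
      ∫ u in Ioc 0 t, (if u < s then φ u else 0) = ∫ u in (0:ℝ)..s, φ u := by
    intro s hs φ
    rw [intervalIntegral.integral_of_le hs.1.le, integral_Ioc_eq_integral_Ioo (x := 0) (y := s),
      ← integral_indicator measurableSet_Ioc, ← integral_indicator measurableSet_Ioo]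
    congr 1
    ext u
    simp only [indicator, mem_Ioc, mem_Ioo]
    have := hs.2
    clear * - this
    split_ifs <;> first | rfl | grind
  have seci : ∀ s ∈ Ioc 0 t, IntegrableOn (fun u => F s u) (Ioc 0 t) := by
    intro s hs
    have h := (intervalIntegrable_kernel_mul (t := s) (a := 0) (b := s) hη
      hf.continuousOn).const_mul ((t - s) ^ (γ - 1))
    rw [intervalIntegrable_iff_integrableOn_Ioo_of_le hs.1.le] at h
    rw [← integrable_indicator_iff measurableSet_Ioo] at h
    rw [← integrable_indicator_iff measurableSet_Ioc]
    refine h.congr (Eventually.of_forall fun u => ?_)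
    simp only [hF, indicator, mem_Ioc, mem_Ioo]
    have := hs.2
    clear * - this
    split_ifs <;> first | rfl | grind
  have hint : Integrable (Function.uncurry F)
      ((volume.restrict (Ioc 0 t)).prod (volume.restrict (Ioc 0 t))) := by
    rw [integrable_prod_iff hFm.aestronglyMeasurable]
    refine ⟨?_, ?_⟩
    · filter_upwards [ae_restrict_mem measurableSet_Ioc] with s hs
      exact seci s hs
    · have hb : IntegrableOn (fun s => (t - s) ^ (γ - 1) * (M * (s ^ η / η))) (Ioc 0 t) := by
        rw [← intervalIntegrable_iff_integrableOn_Ioc_of_le ht]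
        refine intervalIntegrable_kernel_mul hγ (Continuous.continuousOn ?_)
        have : Continuous fun t : ℝ => t ^ η := Real.continuous_rpow_const hη.le
        fun_prop
      refine Integrable.mono' hb ?_ ?_
      · exact (hFm.norm.aestronglyMeasurable (μ := (volume.restrict (Ioc 0 t)).prod
          (volume.restrict (Ioc 0 t)))).integral_prod_right'
      · filter_upwards [ae_restrict_mem measurableSet_Ioc] with s hs
        rw [Real.norm_of_nonneg (integral_nonneg fun _ => norm_nonneg _)]
        have hts : 0 ≤ (t - s) ^ (γ - 1) := Real.rpow_nonneg (by linarith [hs.2]) _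
        have e1 : ∫ u in Ioc 0 t, ‖Function.uncurry F (s, u)‖
            = ∫ u in (0:ℝ)..s, (t - s) ^ (γ - 1) * |(s - u) ^ (η - 1) * f u| := by
          rw [← sec s hs]
          congr 1
          ext u
          simp only [Function.uncurry, hF]
          split_ifs
          · rw [norm_mul, Real.norm_of_nonneg hts, Real.norm_eq_abs]
          · simp
        rw [e1, intervalIntegral.integral_const_mul]
        refine mul_le_mul_of_nonneg_left ?_ hts
        have e2 : ∫ u in (0:ℝ)..s, (s - u) ^ (η - 1) * M = M * (s ^ η / η) := by
          rw [intervalIntegral.integral_mul_const, mul_comm]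
          congr 1
          have := intervalIntegral.integral_comp_sub_left (a := 0) (b := s)
            (fun u => u ^ (η - 1)) s
          rw [this, sub_self, sub_zero, integral_rpow (Or.inl (by linarith))]
          simp [Real.zero_rpow hη.ne']
        rw [← e2]
        refine intervalIntegral.integral_mono_on hs.1.le
          (intervalIntegrable_kernel_mul hη hf.continuousOn).abs
          (intervalIntegrable_kernel_mul hη continuousOn_const) ?_
        intro u hu
        have : 0 ≤ (s - u) ^ (η - 1) := Real.rpow_nonneg (by linarith [hu.2]) _
        rw [abs_mul, abs_of_nonneg this]
        exact mul_le_mul_of_nonneg_left (hM u ⟨hu.1, hu.2.trans hs.2⟩) this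
  have hswap := integral_integral_swap hint
  have hG := (Real.Gamma_pos_of_pos hγ).ne'
  have hE := (Real.Gamma_pos_of_pos hη).ne'
  have l : ∫ s in Ioc 0 t, ∫ u in Ioc 0 t, F s u
      = Real.Gamma γ * Real.Gamma η * fracInt γ (fracInt η f) t := by
    unfold fracInt
    rw [intervalIntegral.integral_of_le ht, show ∀ A : ℝ, Real.Gamma γ * Real.Gamma η *
      (1 / Real.Gamma γ * A) = Real.Gamma η * A by intro A; field_simp, ← integral_const_mul]
    refine setIntegral_congr_fun measurableSet_Ioc fun s hs => ?_
    simp only [hF]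
    rw [sec s hs, intervalIntegral.integral_const_mul]
    field_simp
  have r : ∫ u in Ioc 0 t, ∫ s in Ioc 0 t, F s u
      = Real.Gamma γ * Real.Gamma η * fracInt (γ + η) f t := by
    unfold fracInt
    rw [intervalIntegral.integral_of_le ht, ← mul_assoc, ← integral_const_mul,
      integral_Ioc_eq_integral_Ioo, integral_Ioc_eq_integral_Ioo]
    refine setIntegral_congr_fun measurableSet_Ioo fun u hu => ?_
    have e : ∫ s in Ioc 0 t, F s u
        = ∫ s in u..t, f u * ((t - s) ^ (γ - 1) * (s - u) ^ (η - 1)) := by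
      rw [intervalIntegral.integral_of_le hu.2.le,
        ← integral_indicator measurableSet_Ioc, ← integral_indicator measurableSet_Ioc]
      congr 1
      ext s
      simp only [hF, indicator, mem_Ioc]
      have := hu.1
      clear * - this
      split_ifs <;> first | rfl | ring1 | grind
    rw [e, intervalIntegral.integral_const_mul, integral_sub_rpow_mul_sub_rpow hγ hη hu.2]
    ring
  rw [l, r] at hswap
  exact mul_left_cancel₀ (mul_ne_zero hG hE) hswap

theorem fracInt_add {γ t : ℝ} {f g : ℝ → ℝ}
    (hf : IntervalIntegrable (fun s => (t - s) ^ (γ - 1) * f s) volume 0 t)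
    (hg : IntervalIntegrable (fun s => (t - s) ^ (γ - 1) * g s) volume 0 t) :
    fracInt γ (fun s => f s + g s) t = fracInt γ f t + fracInt γ g t := by
  unfold fracInt
  simp only [mul_add]
  rw [intervalIntegral.integral_add hf hg, mul_add]

theorem fracInt_const_mul (γ t c : ℝ) (f : ℝ → ℝ) :
    fracInt γ (fun s => c * f s) t = c * fracInt γ f t := by
  unfold fracInt
  simp only [mul_left_comm _ c]
  rw [intervalIntegral.integral_const_mul, mul_left_comm]

theorem fracInt_const {γ t : ℝ} (hγ : 0 < γ) (c : ℝ) (ht : 0 < t) :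
    fracInt γ (fun _ => c) t = c * (t ^ γ / Real.Gamma (γ + 1)) := by
  have h := fracInt_rpow hγ one_pos ht
  simp only [sub_self, Real.rpow_zero, Real.Gamma_one, div_one, add_sub_cancel_right] at h
  have h2 := fracInt_const_mul γ t c (fun _ => 1)
  rw [h] at h2
  simpa using h2

theorem continuous_fracInt_one {g : ℝ → ℝ} (hg : Continuous g) : Continuous (fracInt 1 g) := by
  have : fracInt 1 g = fun t => ∫ s in (0:ℝ)..t, g s := funext fun t => fracInt_one g t
  rw [this]
  exact intervalIntegral.continuous_primitive (fun a b => hg.intervalIntegrable a b) 0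

theorem fracInt_eq_add_fracInt_succ {γ c t : ℝ} {f g : ℝ → ℝ} (hγ : 0 < γ) (hg : Continuous g)
    (hf : ∀ s ≥ 0, f s = c + ∫ u in (0:ℝ)..s, g u) (ht : 0 < t) :
    fracInt γ f t = c * (t ^ γ / Real.Gamma (γ + 1)) + fracInt (γ + 1) g t := by
  rw [fracInt_congr (g := fun s => c + fracInt 1 g s) ht.le
    fun s hs => by rw [hf s hs.1.le, fracInt_one], fracInt_add, fracInt_const hγ c ht,
    fracInt_fracInt hγ one_pos hg ht.le]
  · exact intervalIntegrable_kernel_mul hγ continuousOn_const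
  · exact intervalIntegrable_kernel_mul hγ (continuous_fracInt_one hg).continuousOn

/-- The derivative of `fracInt γ f` at a positive point, where `c = f 0` and `g = f'`. -/
noncomputable def fracSlope (γ c : ℝ) (g : ℝ → ℝ) (t : ℝ) : ℝ :=
  c * (t ^ (γ - 1) / Real.Gamma γ) + fracInt γ g t

theorem hasDerivAt_fracInt {γ c t : ℝ} {f g : ℝ → ℝ} (hγ : 0 < γ) (hg : Continuous g)
    (hf : ∀ s ≥ 0, f s = c + ∫ u in (0:ℝ)..s, g u) (ht : 0 < t) :
    HasDerivAt (fracInt γ f) (fracSlope γ c g t) t := by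
  have hev : fracInt γ f =ᶠ[nhds t]
      fun t => c * (t ^ γ / Real.Gamma (γ + 1)) + ∫ s in (0:ℝ)..t, fracInt γ g s := by
    filter_upwards [lt_mem_nhds ht] with s hs
    rw [fracInt_eq_add_fracInt_succ hγ hg hf hs, add_comm γ 1,
      ← fracInt_fracInt one_pos hγ hg hs.le, fracInt_one]
  refine HasDerivAt.congr_of_eventuallyEq ?_ hev
  have hc := continuousOn_fracInt hγ hg
  have hG := (Real.Gamma_pos_of_pos hγ).ne'
  have h1 : HasDerivAt (fun t : ℝ => c * (t ^ γ / Real.Gamma (γ + 1)))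
      (c * (t ^ (γ - 1) / Real.Gamma γ)) t := by
    have := ((Real.hasDerivAt_rpow_const (p := γ) (Or.inl ht.ne')).div_const
      (Real.Gamma (γ + 1))).const_mul c
    convert! this using 2
    rw [Real.Gamma_add_one hγ.ne']
    field_simp
  refine h1.add (intervalIntegral.integral_hasDerivAt_right ?_ ?_ ?_)
  · refine ContinuousOn.intervalIntegrable (hc.mono ?_)
    rw [uIcc_of_le ht.le]
    exact Icc_subset_Ici_self
  · exact hc.stronglyMeasurableAtFilter_nhdsWithin measurableSet_Ici t |>.filter_mono
      (by rw [nhdsWithin_eq_nhds.2 (Ici_mem_nhds ht)])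
  · exact hc.continuousAt (Ici_mem_nhds ht)

theorem hasDerivAt_fracSlope {γ c d t : ℝ} {g k : ℝ → ℝ} (hγ : 0 < γ) (hk : Continuous k)
    (hg : ∀ s ≥ 0, g s = d + ∫ u in (0:ℝ)..s, k u) (ht : 0 < t) :
    HasDerivAt (fracSlope γ c g)
      (c * ((γ - 1) * t ^ (γ - 2) / Real.Gamma γ) + fracSlope γ d k t) t := by
  refine HasDerivAt.add ?_ (hasDerivAt_fracInt hγ hk hg ht)
  have := ((Real.hasDerivAt_rpow_const (p := γ - 1) (Or.inl ht.ne')).div_const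
      (Real.Gamma γ)).const_mul c
  convert! this using 5
  ring

theorem intervalIntegrable_fracSlope {γ c t : ℝ} {g : ℝ → ℝ} (hγ : 0 < γ) (hg : Continuous g)
    (ht : 0 ≤ t) : IntervalIntegrable (fracSlope γ c g) volume 0 t := by
  refine IntervalIntegrable.add (((intervalIntegral.intervalIntegrable_rpow'
    (by linarith)).div_const _).const_mul _) ?_
  refine ContinuousOn.intervalIntegrable ((continuousOn_fracInt hγ hg).mono ?_)
  rw [uIcc_of_le ht]
  exact Icc_subset_Ici_self

theorem intervalIntegrable_kernel_mul_rpow {γ η t : ℝ} (hγ : 0 < γ) (hη : 0 < η) (ht : 0 < t) :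
    IntervalIntegrable (fun s => (t - s) ^ (γ - 1) * (s ^ (η - 1) / Real.Gamma η))
      volume 0 t := by
  have h := integral_sub_rpow_mul_sub_rpow hγ hη ht
  simp only [sub_zero] at h
  have hi := intervalIntegral.intervalIntegrable_of_integral_ne_zero (by
    rw [h]
    have := Real.Gamma_pos_of_pos hγ
    have := Real.Gamma_pos_of_pos hη
    have := Real.Gamma_pos_of_pos (add_pos hγ hη)
    positivity :
      ∫ s in (0:ℝ)..t, (t - s) ^ (γ - 1) * s ^ (η - 1) ≠ 0)
  simpa only [mul_div_assoc] using hi.div_const (Real.Gamma η)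

theorem continuousOn_uIcc_fracInt {γ t : ℝ} {g : ℝ → ℝ} (hγ : 0 < γ) (hg : Continuous g)
    (ht : 0 ≤ t) : ContinuousOn (fracInt γ g) (uIcc 0 t) := by
  refine (continuousOn_fracInt hγ hg).mono ?_
  rw [uIcc_of_le ht]
  exact Icc_subset_Ici_self

theorem intervalIntegrable_kernel_mul_fracSlope {γ η c t : ℝ} {g : ℝ → ℝ} (hγ : 0 < γ)
    (hη : 0 < η) (hg : Continuous g) (ht : 0 < t) :
    IntervalIntegrable (fun s => (t - s) ^ (γ - 1) * fracSlope η c g s) volume 0 t := by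
  have h1 := (intervalIntegrable_kernel_mul_rpow hγ hη ht).const_mul c
  have h2 := intervalIntegrable_kernel_mul (t := t) hγ (continuousOn_uIcc_fracInt hη hg ht.le)
  refine (h1.add h2).congr fun s _ => ?_
  simp only [fracSlope]
  ring

theorem fracInt_fracSlope {γ η c t : ℝ} {g : ℝ → ℝ} (hγ : 0 < γ) (hη : 0 < η)
    (hg : Continuous g) (ht : 0 < t) :
    fracInt γ (fracSlope η c g) t
      = c * (t ^ (γ + η - 1) / Real.Gamma (γ + η)) + fracInt (γ + η) g t := by
  unfold fracSlope
  rw [fracInt_add, fracInt_const_mul, fracInt_rpow hγ hη ht, fracInt_fracInt hγ hη hg ht.le]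
  · simpa only [mul_left_comm] using (intervalIntegrable_kernel_mul_rpow hγ hη ht).const_mul c
  · exact intervalIntegrable_kernel_mul hγ (continuousOn_uIcc_fracInt hη hg ht.le)

theorem caputoD_one_sub {δ t : ℝ} {x X : ℝ → ℝ} (hδ : 0 < δ) (hδ1 : δ < 1) (hX : Continuous X)
    (hx : ∀ s ≥ 0, x s = x 0 + ∫ u in (0:ℝ)..s, X u) (ht : 0 < t) :
    caputoD (1 - δ) x t = fracInt δ X t := by
  have hc : ⌈1 - δ⌉₊ = 1 := by
    rw [Nat.ceil_eq_iff one_ne_zero]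
    constructor <;> norm_num <;> linarith
  unfold caputoD
  rw [hc, iteratedDeriv_one, Nat.cast_one, sub_sub_cancel]
  have h := hasDerivAt_fracInt (c := 0) (f := fun s => x s - taylorPolyAt0 1 x s) hδ hX
    (fun s hs => by simp [taylorPolyAt0, hx s hs]) ht
  rw [h.deriv]
  simp [fracSlope]

theorem caputoD_two_sub {δ t : ℝ} {x X Y : ℝ → ℝ} (hδ : 0 < δ) (hδ1 : δ < 1)
    (hX : Continuous X) (hY : Continuous Y)
    (hx : ∀ s ≥ 0, x s = x 0 + ∫ u in (0:ℝ)..s, X u)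
    (hXY : ∀ s ≥ 0, X s = X 0 + ∫ u in (0:ℝ)..s, Y u) (ht : 0 < t) :
    caputoD (2 - δ) x t = fracSlope δ (X 0 - deriv x 0) Y t := by
  have hc : ⌈2 - δ⌉₊ = 2 := by
    rw [Nat.ceil_eq_iff two_ne_zero]
    constructor <;> norm_num <;> linarith
  unfold caputoD
  rw [hc, iteratedDeriv_succ, iteratedDeriv_one, Nat.cast_two, sub_sub_cancel]
  have h1 : ∀ s > 0, HasDerivAt (fun t => fracInt δ (fun s => x s - taylorPolyAt0 2 x s) t)
      (fracInt δ (fun u => X u - deriv x 0) s) s := by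
    intro s hs
    have hXc : Continuous fun u => X u - deriv x 0 := hX.sub continuous_const
    have h := hasDerivAt_fracInt (c := 0) (f := fun s => x s - taylorPolyAt0 2 x s) hδ
      hXc (fun s hs => by
        rw [intervalIntegral.integral_sub (hX.intervalIntegrable _ _)
          (continuous_const.intervalIntegrable _ _)]
        simp [taylorPolyAt0, hx s hs, Finset.sum_range_succ]
        ring) hs
    simpa [fracSlope] using h
  have h2 : deriv (fun t => fracInt δ (fun s => x s - taylorPolyAt0 2 x s) t)
      =ᶠ[nhds t] fracInt δ (fun u => X u - deriv x 0) := by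
    filter_upwards [lt_mem_nhds ht] with s hs using (h1 s hs).deriv
  rw [h2.deriv_eq]
  refine (hasDerivAt_fracInt hδ hY (fun s hs => ?_) ht).deriv
  rw [hXY s hs]
  ring

theorem exists_continuous_primitive {x : ℝ → ℝ} (hx : ContDiffOn ℝ 1 x (Ici 0)) :
    Continuous (fun t => derivWithin x (Ici 0) (max t 0)) ∧
      ∀ s ≥ 0, x s = x 0 + ∫ u in (0:ℝ)..s, derivWithin x (Ici 0) (max u 0) := by
  have h0 : ContinuousOn (derivWithin x (Ici 0)) (Ici 0) :=
    hx.continuousOn_derivWithin (uniqueDiffOn_Ici 0) le_rfl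
  have h1 : Continuous (fun t => derivWithin x (Ici 0) (max t 0)) :=
    h0.comp_continuous (continuous_id.max continuous_const) fun t => mem_Ici.2 (le_max_right _ _)
  refine ⟨h1, fun s hs => ?_⟩
  rw [intervalIntegral.integral_eq_sub_of_hasDerivAt_of_le hs
    (hx.continuousOn.mono Icc_subset_Ici_self) (fun u hu => ?_) (h1.intervalIntegrable _ _)]
  · ring
  · rw [max_eq_left hu.1.le]
    have hd := (hx.differentiableOn one_ne_zero).differentiableAt (Ici_mem_nhds hu.1)
    exact hd.hasDerivAt.congr_deriv (derivWithin_of_mem_nhds (Ici_mem_nhds hu.1)).symm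

theorem exists_second_order_representation {x : ℝ → ℝ} (hx : ContDiffOn ℝ 2 x (Ici 0)) :
    ∃ X Y : ℝ → ℝ, Continuous X ∧ Continuous Y ∧
      (∀ s ≥ 0, x s = x 0 + ∫ u in (0:ℝ)..s, X u) ∧
      ∀ s ≥ 0, X s = X 0 + ∫ u in (0:ℝ)..s, Y u := by
  have hd : ContDiffOn ℝ 1 (derivWithin x (Ici 0)) (Ici 0) :=
    hx.derivWithin (uniqueDiffOn_Ici 0) (by norm_num)
  obtain ⟨h2, h3⟩ := exists_continuous_primitive (hx.of_le (by norm_num))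
  obtain ⟨k2, k3⟩ := exists_continuous_primitive hd
  refine ⟨_, _, h2, k2, h3, fun s hs => ?_⟩
  simpa [max_eq_left hs] using k3 s hs

theorem exists_abs_fracInt_le_of_antitoneOn {δ T C : ℝ} {P : ℝ → ℝ} (hδ : 0 < δ) (hδ1 : δ < 1)
    (hT : 0 < T) (hPi : ∀ t ≥ 0, IntervalIntegrable P volume 0 t)
    (hk : ∀ t > 0, IntervalIntegrable (fun s => (t - s) ^ (1 - δ - 1) * P s) volume 0 t)
    (hP0 : ∀ t ≥ T, 0 ≤ P t) (hPa : AntitoneOn P (Ici T))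
    (hC : ∀ t ≥ T, ∫ s in T..t, P s ≤ C) :
    ∃ M, ∀ t ≥ 4 * T, |fracInt (1 - δ) P t| ≤ M * t ^ (-δ) := by
  have hG := Real.Gamma_pos_of_pos (sub_pos.2 hδ1)
  have hd1 : 0 < 1 - δ := sub_pos.2 hδ1
  set K := ∫ s in (0:ℝ)..T, |P s| with hK
  refine ⟨1 / Real.Gamma (1 - δ) * ((1 / 2) ^ (-δ) * (K + C + 2 * C / (1 - δ))), fun t ht => ?_⟩
  have ht0 : 0 < t := by linarith
  set m := t / 2 with hm
  have hm0 : 0 < m := by positivity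
  have hTm : T ≤ m := by linarith
  have hmt : m ≤ t := by linarith
  have hkt := hk t ht0
  have hk1 := hkt.mono_set (c := 0) (d := m) (by
    rw [uIcc_of_le hm0.le, uIcc_of_le ht0.le]
    exact Icc_subset_Icc_right hmt)
  have hk2 := hkt.mono_set (c := m) (d := t) (by
    rw [uIcc_of_le hmt, uIcc_of_le ht0.le]
    exact Icc_subset_Icc_left hm0.le)
  have hPT := hPi T hT.le
  have hPTm : IntervalIntegrable P volume T m := (hPi m hm0.le).mono_set (by
    rw [uIcc_of_le hm0.le, uIcc_of_le hTm]
    exact Icc_subset_Icc_left hT.le)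
  have hker : ∀ s ∈ Ioc 0 m, (t - s) ^ (1 - δ - 1) ≤ m ^ (-δ) := by
    intro s hs
    rw [show 1 - δ - 1 = -δ by ring]
    exact Real.rpow_le_rpow_of_nonpos hm0 (by linarith [hs.2]) (by linarith)
  have b1 : |∫ s in (0:ℝ)..m, (t - s) ^ (1 - δ - 1) * P s| ≤ m ^ (-δ) * (K + C) := by
    have h1 : |∫ s in (0:ℝ)..m, (t - s) ^ (1 - δ - 1) * P s| ≤ ∫ s in (0:ℝ)..m, m ^ (-δ) * |P s| := by
      rw [← Real.norm_eq_abs]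
      refine intervalIntegral.norm_integral_le_of_norm_le hm0.le
        (Eventually.of_forall fun s hs => ?_) ((hPi m hm0.le).norm.const_mul _)
      rw [norm_mul, Real.norm_of_nonneg (Real.rpow_nonneg (by linarith [hs.2]) _)]
      exact mul_le_mul_of_nonneg_right (hker s hs) (abs_nonneg _)
    refine h1.trans ?_
    rw [intervalIntegral.integral_const_mul]
    refine mul_le_mul_of_nonneg_left ?_ (Real.rpow_nonneg hm0.le _)
    rw [← intervalIntegral.integral_add_adjacent_intervals hPT.abs hPTm.abs]
    refine add_le_add le_rfl ?_
    have : ∫ s in T..m, |P s| = ∫ s in T..m, P s := by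
      refine intervalIntegral.integral_congr fun s hs => ?_
      rw [uIcc_of_le hTm] at hs
      exact abs_of_nonneg (hP0 s hs.1)
    rw [this]
    exact hC m hTm
  have b2 : |∫ s in m..t, (t - s) ^ (1 - δ - 1) * P s| ≤ P m * (m ^ (1 - δ) / (1 - δ)) := by
    have h1 : |∫ s in m..t, (t - s) ^ (1 - δ - 1) * P s|
        ≤ ∫ s in m..t, (t - s) ^ (1 - δ - 1) * P m := by
      rw [← Real.norm_eq_abs]
      refine intervalIntegral.norm_integral_le_of_norm_le hmt
        (Eventually.of_forall fun s hs => ?_)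
        ((intervalIntegrable_sub_rpow (r := 1 - δ - 1) (by linarith) t m t).mul_const _)
      have hs1 : T ≤ s := hTm.trans hs.1.le
      have h0 : 0 ≤ (t - s) ^ (1 - δ - 1) := Real.rpow_nonneg (by linarith [hs.2]) _
      rw [norm_mul, Real.norm_of_nonneg h0, Real.norm_of_nonneg (hP0 s hs1)]
      exact mul_le_mul_of_nonneg_left (hPa hTm hs1 hs.1.le) h0
    refine h1.trans (le_of_eq ?_)
    rw [intervalIntegral.integral_mul_const, mul_comm]
    congr 1
    have := intervalIntegral.integral_comp_sub_left (a := m) (b := t)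
      (fun u => u ^ (1 - δ - 1)) t
    rw [this, sub_self, integral_rpow (Or.inl (by linarith)), sub_add_cancel,
      Real.zero_rpow hd1.ne', sub_zero]
    congr 2
    rw [hm]
    ring
  have b3 : P m * m ≤ 2 * C := by
    have h1 : ∫ s in T..m, P m ≤ ∫ s in T..m, P s :=
      intervalIntegral.integral_mono_on hTm intervalIntegrable_const hPTm
        fun s hs => hPa hs.1 hTm hs.2
    rw [intervalIntegral.integral_const, smul_eq_mul] at h1
    have h2 := hC m hTm
    have h3 := hP0 m hTm
    nlinarith
  have b4 : P m * (m ^ (1 - δ) / (1 - δ)) ≤ m ^ (-δ) * (2 * C / (1 - δ)) := by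
    rw [show (1 - δ) = -δ + 1 by ring, Real.rpow_add_one hm0.ne', ← show (1 - δ) = -δ + 1 by ring]
    have : 0 ≤ m ^ (-δ) / (1 - δ) := by positivity
    calc P m * (m ^ (-δ) * m / (1 - δ)) = m ^ (-δ) / (1 - δ) * (P m * m) := by ring
      _ ≤ m ^ (-δ) / (1 - δ) * (2 * C) := mul_le_mul_of_nonneg_left b3 this
      _ = _ := by ring
  have hmd : m ^ (-δ) = (1 / 2) ^ (-δ) * t ^ (-δ) := by
    rw [← Real.mul_rpow (by norm_num) ht0.le, hm]
    congr 1
    ring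
  unfold fracInt
  rw [abs_mul, abs_of_pos (by positivity), mul_assoc]
  refine mul_le_mul_of_nonneg_left ?_ (by positivity)
  rw [← intervalIntegral.integral_add_adjacent_intervals hk1 hk2]
  refine (abs_add_le _ _).trans ((add_le_add b1 (b2.trans b4)).trans (le_of_eq ?_))
  rw [hmd]
  ring

theorem exists_neg_le_fracInt {μ δ T : ℝ} {x : ℝ → ℝ} (hμ : 0 < μ) (hμδ : μ + δ ≤ 1)
    (hT : 0 < T) (hx : ContinuousOn x (Ici 0)) (hpos : ∀ t ≥ T, 0 ≤ x t) (hδ : 0 ≤ δ) :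
    ∃ M ≥ 0, ∀ t ≥ max (2 * T) 2, -(M * t ^ (-δ)) ≤ fracInt μ x t := by
  have hG := Real.Gamma_pos_of_pos hμ
  have hxi : ∀ a b, 0 ≤ a → a ≤ b → ContinuousOn x (uIcc a b) := fun a b ha hab => by
    refine hx.mono ?_
    rw [uIcc_of_le hab]
    exact fun u hu => ha.trans hu.1
  have hK : 0 ≤ ∫ s in (0:ℝ)..T, |x s| :=
    intervalIntegral.integral_nonneg hT.le fun s _ => abs_nonneg _
  refine ⟨1 / Real.Gamma μ * ((1 / 2) ^ (-δ) * ∫ s in (0:ℝ)..T, |x s|), by positivity,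
    fun t ht => ?_⟩
  have ht2 : 2 * T ≤ t := (le_max_left _ _).trans ht
  have ht3 : 2 ≤ t := (le_max_right _ _).trans ht
  have htT : T ≤ t := by linarith
  have hhalf : (t / 2) ^ (-δ) = (1 / 2) ^ (-δ) * t ^ (-δ) := by
    rw [← Real.mul_rpow (by norm_num) (by linarith)]
    congr 1
    ring
  have b1 : |∫ s in (0:ℝ)..T, (t - s) ^ (μ - 1) * x s|
      ≤ (t / 2) ^ (-δ) * ∫ s in (0:ℝ)..T, |x s| := by
    rw [← intervalIntegral.integral_const_mul]
    rw [← Real.norm_eq_abs]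
    refine intervalIntegral.norm_integral_le_of_norm_le hT.le
      (Eventually.of_forall fun s hs => ?_)
      ((hxi 0 T le_rfl hT.le).intervalIntegrable.norm.const_mul _)
    have hs2 := hs.2
    rw [norm_mul, Real.norm_of_nonneg (Real.rpow_nonneg (by linarith) _)]
    refine mul_le_mul_of_nonneg_right ?_ (abs_nonneg _)
    calc (t - s) ^ (μ - 1) ≤ (t / 2) ^ (μ - 1) :=
          Real.rpow_le_rpow_of_nonpos (by linarith) (by linarith) (by linarith)
      _ ≤ (t / 2) ^ (-δ) := Real.rpow_le_rpow_of_exponent_le (by linarith) (by linarith)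
  have b2 : 0 ≤ ∫ s in T..t, (t - s) ^ (μ - 1) * x s :=
    intervalIntegral.integral_nonneg htT fun s hs =>
      mul_nonneg (Real.rpow_nonneg (by linarith [hs.2]) _) (hpos s hs.1)
  unfold fracInt
  rw [← intervalIntegral.integral_add_adjacent_intervals
    (intervalIntegrable_kernel_mul hμ (hxi 0 T le_rfl hT.le))
    (intervalIntegrable_kernel_mul hμ (hxi T t hT.le htT)), mul_assoc, ← mul_neg]
  refine mul_le_mul_of_nonneg_left ?_ (by positivity)
  rw [hhalf] at b1
  have := neg_le_of_abs_le b1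
  linarith

theorem exists_abs_le_of_monotoneOn_of_nonpos {H P : ℝ → ℝ} {T : ℝ}
    (hH : ∀ t ≥ T, HasDerivAt H (P t) t) (hP : ∀ t ≥ T, 0 ≤ P t) (hn : ∀ t ≥ T, H t ≤ 0) :
    ∃ C, ∀ t ≥ T, |H t| ≤ C := by
  have hm : MonotoneOn H (Ici T) := by
    refine monotoneOn_of_deriv_nonneg (convex_Ici T)
      (fun t ht => (hH t ht).continuousAt.continuousWithinAt)
      (fun t ht => (hH t (interior_subset ht)).differentiableAt.differentiableWithinAt)
      fun t ht => ?_
    rw [(hH t (interior_subset ht)).deriv]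
    exact hP t (interior_subset ht)
  refine ⟨|H T|, fun t ht => ?_⟩
  rw [abs_of_nonpos (hn t ht), abs_of_nonpos (hn T le_rfl)]
  exact neg_le_neg (hm self_mem_Ici ht ht)

/-- Decay of `x` when `y₁ = A I^δ x + b I^(δ+μ) x` is bounded and `σ y₁'` is nonnegative
and nonincreasing near infinity. -/
theorem exists_abs_le_rpow_of_bounded {δ μ A b σ C T : ℝ} {x X y₁ y₂ y₃ : ℝ → ℝ}
    (hδ : 0 < δ) (hμ : 0 < μ) (hδμ : δ + μ < 1) (hA : 0 < A) (hb : 0 ≤ b)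
    (hxc : ContinuousOn x (Ici 0)) (hX : Continuous X)
    (hx : ∀ s ≥ 0, x s = x 0 + ∫ u in (0:ℝ)..s, X u)
    (hT : 0 < T)
    (hy₁ : ∀ t ≥ T, HasDerivAt y₁ (y₂ t) t)
    (hy₂ : ∀ t > 0, y₂ t = A * fracSlope δ (x 0) X t + b * fracSlope (δ + μ) (x 0) X t)
    (hy₃ : ∀ t ≥ T, HasDerivAt y₂ (y₃ t) t)
    (hσ : σ = 1 ∨ σ = -1) (hC : ∀ t ≥ T, |y₁ t| ≤ C)
    (h₂ : ∀ t ≥ T, 0 ≤ σ * y₂ t) (h₃ : ∀ t ≥ T, σ * y₃ t ≤ 0)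
    (hpos : ∀ t ≥ T, 0 < x t) :
    ∃ M > (0:ℝ), ∃ T > (0:ℝ), ∀ t ≥ T, |x t| ≤ M * t ^ (-δ) := by
  have hσ1 : |σ| = 1 := by rcases hσ with rfl | rfl <;> simp
  have hδμ0 : 0 < δ + μ := by linarith
  have hδ1 : 0 < 1 - δ := by linarith
  have hP : ∀ t ≥ 0, IntervalIntegrable (fun s => σ * y₂ s) volume 0 t := fun t ht => by
    refine ((((intervalIntegrable_fracSlope (c := x 0) hδ hX ht).const_mul A).add
      ((intervalIntegrable_fracSlope (c := x 0) hδμ0 hX ht).const_mul b)).const_mul σ).congr fun s hs => ?_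
    rw [uIoc_of_le ht] at hs
    simp only [hy₂ s hs.1]
  have hk1 : ∀ t > 0, IntervalIntegrable
      (fun s => (t - s) ^ (1 - δ - 1) * (A * fracSlope δ (x 0) X s)) volume 0 t := fun t ht => by
    simpa only [mul_left_comm] using
      (intervalIntegrable_kernel_mul_fracSlope (c := x 0) hδ1 hδ hX ht).const_mul A
  have hk2 : ∀ t > 0, IntervalIntegrable
      (fun s => (t - s) ^ (1 - δ - 1) * (b * fracSlope (δ + μ) (x 0) X s)) volume 0 t :=
    fun t ht => by
    simpa only [mul_left_comm] using
      (intervalIntegrable_kernel_mul_fracSlope (c := x 0) hδ1 hδμ0 hX ht).const_mul b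
  have hk : ∀ t > 0, IntervalIntegrable (fun s => (t - s) ^ (1 - δ - 1) * (σ * y₂ s))
      volume 0 t := fun t ht => by
    refine (((hk1 t ht).add (hk2 t ht)).const_mul σ).congr fun s hs => ?_
    rw [uIoc_of_le ht.le] at hs
    simp only [hy₂ s hs.1]
    ring
  have hanti : AntitoneOn (fun s => σ * y₂ s) (Ici T) := by
    have hd : ∀ t ≥ T, HasDerivAt (fun s => σ * y₂ s) (σ * y₃ t) t :=
      fun t ht => (hy₃ t ht).const_mul σ
    refine antitoneOn_of_deriv_nonpos (convex_Ici T)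
      (fun t ht => (hd t ht).continuousAt.continuousWithinAt)
      (fun t ht => (hd t (interior_subset ht)).differentiableAt.differentiableWithinAt)
      fun t ht => ?_
    rw [(hd t (interior_subset ht)).deriv]
    exact h₃ t (interior_subset ht)
  have hint : ∀ t ≥ T, ∫ s in T..t, σ * y₂ s ≤ 2 * C := by
    intro t ht
    rw [intervalIntegral.integral_const_mul, intervalIntegral.integral_eq_sub_of_hasDerivAt]
    · calc σ * (y₁ t - y₁ T) ≤ |σ * (y₁ t - y₁ T)| := le_abs_self _
        _ = |y₁ t - y₁ T| := by rw [abs_mul, hσ1, one_mul]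
        _ ≤ |y₁ t| + |y₁ T| := abs_sub _ _
        _ ≤ 2 * C := by linarith [hC t ht, hC T le_rfl]
    · intro s hs
      rw [uIcc_of_le ht] at hs
      exact hy₁ s hs.1
    · refine ContinuousOn.intervalIntegrable fun s hs => ?_
      rw [uIcc_of_le ht] at hs
      exact (hy₃ s hs.1).continuousAt.continuousWithinAt
  obtain ⟨M₁, hM₁⟩ := exists_abs_fracInt_le_of_antitoneOn hδ (by linarith) hT hP hk h₂ hanti hint
  obtain ⟨M₂, hM₂0, hM₂⟩ := exists_neg_le_fracInt (δ := δ) hμ (by linarith) hT hxc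
    (fun t ht => (hpos t ht).le) hδ.le
  have hw : ∀ t > 0, fracInt (1 - δ) (fun s => σ * y₂ s) t
      = σ * (A * x t + b * fracInt μ x t) := by
    intro t ht
    rw [fracInt_const_mul, fracInt_congr (g := fun s => A * fracSlope δ (x 0) X s +
      b * fracSlope (δ + μ) (x 0) X s) ht.le fun s hs => hy₂ s hs.1,
      fracInt_add (hk1 t ht) (hk2 t ht), fracInt_const_mul, fracInt_const_mul,
      fracInt_fracSlope hδ1 hδ hX ht, fracInt_fracSlope hδ1 hδμ0 hX ht,
      fracInt_eq_add_fracInt_succ hμ hX hx ht, hx t ht.le]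
    rw [show 1 - δ + δ = 1 by ring, show 1 - δ + (δ + μ) = μ + 1 by ring, fracInt_one]
    simp
  refine ⟨(|M₁| + b * M₂ + 1) / A, by positivity, max (4 * T) 2, by positivity, fun t ht => ?_⟩
  have ht4 : 4 * T ≤ t := (le_max_left _ _).trans ht
  have ht2 : 2 ≤ t := (le_max_right _ _).trans ht
  have ht0 : 0 < t := by linarith
  have e1 := hM₁ t ht4
  rw [hw t ht0, abs_mul, hσ1, one_mul] at e1
  have e2 := hM₂ t (max_le (by linarith) ht2)
  rw [abs_of_pos (hpos t (by linarith)), div_mul_eq_mul_div, le_div_iff₀ hA]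
  have e3 := mul_le_mul_of_nonneg_left e2 hb
  have e4 := (le_abs_self _).trans e1
  have e5 : 0 < t ^ (-δ) := Real.rpow_pos_of_pos ht0 _
  have e6 : M₁ * t ^ (-δ) ≤ |M₁| * t ^ (-δ) :=
    mul_le_mul_of_nonneg_right (le_abs_self _) e5.le
  nlinarith

theorem exists_abs_le_rpow_of_sign_pattern {δ μ A b : ℝ} {x X Y y₁ y₂ y₃ : ℝ → ℝ}
    (hδ : 0 < δ) (hμ : 0 < μ) (hδμ : δ + μ < 1) (hA : 0 < A) (hb : 0 ≤ b)
    (hxc : ContinuousOn x (Ici 0)) (hX : Continuous X) (hY : Continuous Y)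
    (hx : ∀ s ≥ 0, x s = x 0 + ∫ u in (0:ℝ)..s, X u)
    (hXY : ∀ s ≥ 0, X s = X 0 + ∫ u in (0:ℝ)..s, Y u)
    (hy₁ : ∀ t > 0, y₁ t = A * fracInt δ x t + b * fracInt (δ + μ) x t)
    (hy₂ : ∀ t > 0, y₂ t = A * fracSlope δ (x 0) X t + b * fracSlope (δ + μ) (x 0) X t)
    (hy₃ : ∀ t > 0, y₃ t =
      A * (x 0 * ((δ - 1) * t ^ (δ - 2) / Real.Gamma δ) + fracSlope δ (X 0) Y t) +
      b * (x 0 * ((δ + μ - 1) * t ^ (δ + μ - 2) / Real.Gamma (δ + μ)) +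
        fracSlope (δ + μ) (X 0) Y t))
    (hpos : ∃ T > (0:ℝ), ∀ t ≥ T, 0 < x t)
    (hsign : (∃ T > (0:ℝ), ∀ t ≥ T, 0 < y₁ t ∧ y₂ t < 0 ∧ 0 < y₃ t) ∨
      (∃ T > (0:ℝ), ∀ t ≥ T, y₁ t < 0 ∧ 0 < y₂ t ∧ y₃ t < 0) ∨
      ((∃ C : ℝ, ∀ t ≥ (0:ℝ), |y₁ t| ≤ C) ∧ ∃ T > (0:ℝ), ∀ t ≥ T, 0 < y₂ t ∧ y₃ t < 0)) :
    ∃ M > (0:ℝ), ∃ T > (0:ℝ), ∀ t ≥ T, |x t| ≤ M * t ^ (-δ) := by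
  have hδμ0 : 0 < δ + μ := by linarith
  have hd₁ : ∀ t > 0, HasDerivAt y₁ (y₂ t) t := fun t ht => by
    rw [hy₂ t ht]
    refine (((hasDerivAt_fracInt hδ hX hx ht).const_mul A).add
      ((hasDerivAt_fracInt hδμ0 hX hx ht).const_mul b)).congr_of_eventuallyEq ?_
    filter_upwards [lt_mem_nhds ht] with s hs using hy₁ s hs
  have hd₂ : ∀ t > 0, HasDerivAt y₂ (y₃ t) t := fun t ht => by
    rw [hy₃ t ht]
    refine (((hasDerivAt_fracSlope hδ hY hXY ht).const_mul A).add
      ((hasDerivAt_fracSlope hδμ0 hY hXY ht).const_mul b)).congr_of_eventuallyEq ?_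
    filter_upwards [lt_mem_nhds ht] with s hs using hy₂ s hs
  obtain ⟨T₀, hT₀, hpos⟩ := hpos
  have key : ∀ σ C T : ℝ, (σ = 1 ∨ σ = -1) → 0 < T → (∀ t ≥ T, |y₁ t| ≤ C) →
      (∀ t ≥ T, 0 ≤ σ * y₂ t) → (∀ t ≥ T, σ * y₃ t ≤ 0) →
      ∃ M > (0:ℝ), ∃ T > (0:ℝ), ∀ t ≥ T, |x t| ≤ M * t ^ (-δ) := by
    intro σ C T hσ hT hC h₂ h₃
    have hT' : 0 < max T T₀ := lt_max_of_lt_left hT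
    refine exists_abs_le_rpow_of_bounded (T := max T T₀) hδ hμ hδμ hA hb hxc hX hx hT'
      (fun t ht => hd₁ t (hT'.trans_le ht)) hy₂ (fun t ht => hd₂ t (hT'.trans_le ht)) hσ
      (fun t ht => hC t ((le_max_left _ _).trans ht))
      (fun t ht => h₂ t ((le_max_left _ _).trans ht))
      (fun t ht => h₃ t ((le_max_left _ _).trans ht))
      (fun t ht => hpos t ((le_max_right _ _).trans ht))
  rcases hsign with ⟨T, hT, h⟩ | ⟨T, hT, h⟩ | ⟨⟨C, hC⟩, T, hT, h⟩
  · obtain ⟨C, hC⟩ := exists_abs_le_of_monotoneOn_of_nonpos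
      (fun t ht => (hd₁ t (hT.trans_le ht)).neg) (fun t ht => neg_nonneg.2 (h t ht).2.1.le)
      (fun t ht => neg_nonpos.2 (h t ht).1.le)
    refine key (-1) C T (Or.inr rfl) hT (fun t ht => ?_) (fun t ht => ?_) (fun t ht => ?_)
    · simpa using hC t ht
    · linarith [(h t ht).2.1]
    · linarith [(h t ht).2.2]
  · obtain ⟨C, hC⟩ := exists_abs_le_of_monotoneOn_of_nonpos
      (fun t ht => hd₁ t (hT.trans_le ht)) (fun t ht => (h t ht).2.1.le)
      (fun t ht => (h t ht).1.le)
    refine key 1 C T (Or.inl rfl) hT hC (fun t ht => ?_) (fun t ht => ?_)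
    · linarith [(h t ht).2.1]
    · linarith [(h t ht).2.2]
  · refine key 1 C T (Or.inl rfl) hT (fun t ht => hC t (hT.le.trans ht)) (fun t ht => ?_)
      (fun t ht => ?_)
    · linarith [(h t ht).1]
    · linarith [(h t ht).2]

theorem caputoD_natCast (m : ℕ) (x : ℝ → ℝ) (t : ℝ) : caputoD (m : ℝ) x t = 0 := by
  unfold caputoD fracInt
  simp

theorem caputoD_two_sub_add {δ t : ℝ} {x X Y : ℝ → ℝ} (hδ : 0 < δ) (hδ1 : δ < 1)
    (hX : Continuous X) (hY : Continuous Y)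
    (hx : ∀ s ≥ 0, x s = x 0 + ∫ u in (0:ℝ)..s, X u)
    (hXY : ∀ s ≥ 0, X s = X 0 + ∫ u in (0:ℝ)..s, Y u) (ht : 0 < t) :
    caputoD (2 - δ) x t + (x 0 * ((δ - 1) * δ) * t ^ (δ - 2) / Real.Gamma (δ + 1)
      + deriv x 0 * δ * t ^ (δ - 1) / Real.Gamma (δ + 1))
      = x 0 * ((δ - 1) * t ^ (δ - 2) / Real.Gamma δ) + fracSlope δ (X 0) Y t := by
  have hG := (Real.Gamma_pos_of_pos hδ).ne'
  rw [caputoD_two_sub hδ hδ1 hX hY hx hXY ht, Real.Gamma_add_one hδ.ne']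
  unfold fracSlope
  field_simp
  ring

theorem assocY_three (n : ℕ) (α β a : ℝ) (ξ : ℕ → ℝ) (x : ℝ → ℝ) (t : ℝ) :
    assocY n α β a ξ x 3 t =
      (caputoD (2 - (n - α)) x t +
        (ξ 0 * ((n - α - 1) * (n - α)) * t ^ ((n : ℝ) - α - 2) / Real.Gamma (n - α + 1)
          + ξ 1 * (n - α) * t ^ ((n : ℝ) - α - 1) / Real.Gamma (n - α + 1))) +
      a * (caputoD (2 - (n - β)) x t +
        (ξ 0 * ((n - β - 1) * (n - β)) * t ^ ((n : ℝ) - β - 2) / Real.Gamma (n - β + 1)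
          + ξ 1 * (n - β) * t ^ ((n : ℝ) - β - 1) / Real.Gamma (n - β + 1))) := by
  have e : ∀ γ : ℝ, γ - n - 1 + ((3 : ℕ) : ℝ) = 2 - (n - γ) := fun γ => by push_cast; ring
  have e0 : ∀ γ : ℝ, (n : ℝ) - γ - 3 + 1 = n - γ - 2 := fun γ => by ring
  have e1 : ∀ γ : ℝ, (n : ℝ) - γ - 2 + 1 = n - γ - 1 := fun γ => by ring
  simp only [assocY, e]
  simp [Finset.sum_range_succ, Finset.prod_range_succ, e0, e1]
  ring

/-- under any of the three sign-pattern assumptions on the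
associated functions, an eventually positive solution satisfies
`x(t) = O(t^{α-n})` as `t → ∞`. -/
theorem stmt18
    (n : ℕ) (hn3 : 3 ≤ n)
    (α β a : ℝ)
    (hβ : (n : ℝ) - 1 < β) (hβα : β < α) (hceil : ⌈α⌉₊ = n)
    (ha : 0 < a)
    (f : ℝ → ℝ) (q g : ℝ → ℝ)
    (hfc : Continuous f) (hqc : ContinuousOn q (Set.Ici 0))
    (hgc : ContinuousOn g (Set.Ici 0))
    (ξ : ℕ → ℝ) (x : ℝ → ℝ)
    (hx : ContCaputoDiffOnIci α x)
    (heq : ∀ t > (0:ℝ),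
      caputoD α x t + a * caputoD β x t + q t * f (x t) + Real.sign (x t) * g t = 0)
    (hinit : ∀ i < n, iteratedDeriv i x 0 = ξ i)
    (hxpos : ∃ T > (0:ℝ), ∀ t ≥ T, 0 < x t)
    (hsign :
      (∃ T > (0:ℝ), ∀ t ≥ T, ∀ i, 1 ≤ i → i ≤ n →
        0 < (-1 : ℝ) ^ (i + 1) * assocY n α β a ξ x i t) ∨
      (∃ T > (0:ℝ), ∀ t ≥ T, ∀ i, 1 ≤ i → i ≤ n →
        0 < (-1 : ℝ) ^ i * assocY n α β a ξ x i t) ∨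
      ((∃ C : ℝ, ∀ t ≥ (0:ℝ), |assocY n α β a ξ x 1 t| ≤ C) ∧
        ∃ T > (0:ℝ), ∀ t ≥ T, 0 < assocY n α β a ξ x 1 t ∧
          0 < assocY n α β a ξ x 2 t ∧
          ∀ i, 3 ≤ i → i ≤ n → 0 < (-1 : ℝ) ^ i * assocY n α β a ξ x i t)) :
    ∃ M > (0:ℝ), ∃ T > (0:ℝ), ∀ t ≥ T, |x t| ≤ M * t ^ (α - n) := by
  have hn1 : 1 ≤ n := by omega
  have hx2 : ContDiffOn ℝ 2 x (Set.Ici 0) := by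
    refine hx.1.of_le ?_
    rw [hceil]
    exact_mod_cast (by omega : 2 ≤ n - 1)
  obtain ⟨X, Y, hX, hY, hxX, hXY⟩ := exists_second_order_representation hx2
  have hξ0 : ξ 0 = x 0 := by simpa using (hinit 0 (by omega)).symm
  have hξ1 : ξ 1 = deriv x 0 := by simpa using (hinit 1 (by omega)).symm
  have hαn : α ≤ n := hceil ▸ Nat.le_ceil α
  have hε : 0 < (n : ℝ) - β := by linarith
  have hε1 : (n : ℝ) - β < 1 := by linarith
  have hpat : (∃ T > (0:ℝ), ∀ t ≥ T, 0 < assocY n α β a ξ x 1 t ∧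
        assocY n α β a ξ x 2 t < 0 ∧ 0 < assocY n α β a ξ x 3 t) ∨
      (∃ T > (0:ℝ), ∀ t ≥ T, assocY n α β a ξ x 1 t < 0 ∧
        0 < assocY n α β a ξ x 2 t ∧ assocY n α β a ξ x 3 t < 0) ∨
      ((∃ C : ℝ, ∀ t ≥ (0:ℝ), |assocY n α β a ξ x 1 t| ≤ C) ∧
        ∃ T > (0:ℝ), ∀ t ≥ T, 0 < assocY n α β a ξ x 2 t ∧ assocY n α β a ξ x 3 t < 0) := by
    refine hsign.imp ?_ (Or.imp ?_ (And.imp_right ?_)) <;> rintro ⟨T, hT, h⟩ <;>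
      refine ⟨T, hT, fun t ht => ?_⟩
    · have h1 := h t ht 1 le_rfl hn1
      have h2 := h t ht 2 (by norm_num) (by omega)
      have h3 := h t ht 3 (by norm_num) hn3
      norm_num at h1 h2 h3
      exact ⟨h1, h2, h3⟩
    · have h1 := h t ht 1 le_rfl hn1
      have h2 := h t ht 2 (by norm_num) (by omega)
      have h3 := h t ht 3 (by norm_num) hn3
      norm_num at h1 h2 h3
      exact ⟨h1, h2, h3⟩
    · have h3 := (h t ht).2.2 3 le_rfl hn3
      norm_num at h3
      exact ⟨(h t ht).2.1, h3⟩
  have hr : ∀ γ : ℝ, γ - n + 1 = 1 - (n - γ) := fun γ => by ring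
  rcases hαn.lt_or_eq with hlt | rfl
  · have hδ : 0 < (n : ℝ) - α := by linarith
    have hδ1 : (n : ℝ) - α < 1 := by linarith
    have hs : (n : ℝ) - α + (α - β) = n - β := by ring
    have := exists_abs_le_rpow_of_sign_pattern (μ := α - β) (A := 1) (b := a) hδ (by linarith)
      (by linarith) one_pos ha.le hx2.continuousOn hX hY hxX hXY
      (fun t ht => by simp [assocY, hs])
      (fun t ht => by
        rw [hs]
        simp only [assocY, hr, hξ0, caputoD_one_sub hδ hδ1 hX hxX ht,
          caputoD_one_sub hε hε1 hX hxX ht, fracSlope]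
        ring)
      (fun t ht => by
        rw [hs, assocY_three, hξ0, hξ1, caputoD_two_sub_add hδ hδ1 hX hY hxX hXY ht,
          caputoD_two_sub_add hε hε1 hX hY hxX hXY ht, one_mul])
      hxpos hpat
    rwa [neg_sub] at this
  · have h1 : caputoD 1 x = 0 := funext fun t => by simpa using caputoD_natCast 1 x t
    have h2 : caputoD 2 x = 0 := funext fun t => by simpa using caputoD_natCast 2 x t
    obtain ⟨M, hM, T, hT, h⟩ := exists_abs_le_rpow_of_sign_pattern (μ := (1 - (n - β)) / 2)
      (A := a) (b := 0) hε (by linarith)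
      (by linarith) ha le_rfl hx2.continuousOn hX hY hxX hXY
      (fun t ht => by simp [assocY, fracInt])
      (fun t ht => by
        simp only [assocY, hr, hξ0, caputoD_one_sub hε hε1 hX hxX ht, fracSlope, sub_self]
        simp [h1]
        ring)
      (fun t ht => by
        rw [assocY_three, hξ0, hξ1, caputoD_two_sub_add hε hε1 hX hY hxX hXY ht]
        simp [h2])
      hxpos hpat
    refine ⟨M, hM, max T 1, lt_max_of_lt_left hT, fun t ht => ?_⟩
    refine (h t ((le_max_left _ _).trans ht)).trans (mul_le_mul_of_nonneg_left ?_ hM.le)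
    exact Real.rpow_le_rpow_of_exponent_le ((le_max_right _ _).trans ht) (by linarith)
end
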